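/- Let W be a one-dimensional Wiener process on [0,1] and let ψ be a progressively measurable process with ∫₀¹ ψ_u² du < ∞ a.s. and E[∫₀¹ ψ_u du] = 0 (and F₀ trivial). Then E[∫₀¹ ψ_u² du] ≥ g( E[(W₁ + ∫₀¹ ψ_u du)²] ), where g(y) = y − log y − 1 (the inequality being trivial if the left side is infinite or the argument is 0). -/

import Mathlib

open MeasureTheory ProbabilityTheory

structure IsBrownianMotion {Ω : Type*} [m0 : MeasurableSpace Ω] (μ : Measure Ω)
    (𝔽 : Filtration ℝ m0) (W : ℝ → Ω → ℝ) : Prop where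
  adapted : Adapted 𝔽 W
  init : ∀ ω, W 0 ω = 0
  cont : ∀ ω, Continuous fun t => W t ω
  incr_law : ∀ s t : ℝ, 0 ≤ s → s ≤ t →
    μ.map (fun ω => W t ω - W s ω) = gaussianReal 0 (Real.toNNReal (t - s))
  incr_indep : ∀ s t : ℝ, 0 ≤ s → s ≤ t →
    Indep (MeasurableSpace.comap (fun ω => W t ω - W s ω) inferInstance) (𝔽 s) μ

/-- `g(y) = y - log y - 1`. -/
noncomputable def g (y : ℝ) : ℝ := y - Real.log y - 1


lemma ibp_zero {F G : ℝ → ℝ} {t : ℝ} (hF : IntervalIntegrable F volume 0 t)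
    (hG : IntervalIntegrable G volume 0 t) :
    ∫ x in (0:ℝ)..t, (G x * (∫ v in (0:ℝ)..x, F v) + (∫ v in (0:ℝ)..x, G v) * F x)
      = (∫ v in (0:ℝ)..t, G v) * ∫ v in (0:ℝ)..t, F v := by
  have hFa := hF.absolutelyContinuousOnInterval_intervalIntegral (c := 0) (by simp)
  have hGa := hG.absolutelyContinuousOnInterval_intervalIntegral (c := 0) (by simp)
  have := hGa.integral_deriv_mul_eq_sub hFa
  simp only [intervalIntegral.integral_same, mul_zero, sub_zero] at this
  rw [← this]
  apply intervalIntegral.integral_congr_ae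
  filter_upwards [hF.ae_hasDerivAt_integral, hG.ae_hasDerivAt_integral] with x h1 h2 hx
  have hx' := Set.uIoc_subset_uIcc hx
  rw [(h1 hx' 0 (by simp)).deriv, (h2 hx' 0 (by simp)).deriv]

lemma sq_formula {F : ℝ → ℝ} {t : ℝ} (hF : IntervalIntegrable F volume 0 t) :
    (∫ v in (0:ℝ)..t, F v) ^ 2 = 2 * ∫ x in (0:ℝ)..t, (∫ v in (0:ℝ)..x, F v) * F x := by
  rw [sq, ← ibp_zero hF hF, ← intervalIntegral.integral_const_mul]
  congr 1; ext x; ring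

lemma analytic_core {f h C : ℝ → ℝ} (hh : IntervalIntegrable h volume 0 1)
    (hC : IntervalIntegrable C volume 0 1)
    (hf : ∀ t ∈ Set.Icc (0:ℝ) 1, f t = t + 2 * ∫ u in (0:ℝ)..t, h u)
    (hineq : ∀ᵐ u ∂(volume.restrict (Set.Ioc (0:ℝ) 1)), ∀ p : ℝ, 2 * p * h u ≤ C u + p ^ 2 * f u)
    (hpos : 0 < f 1) : g (f 1) ≤ ∫ u in (0:ℝ)..1, C u := by
  set y := f 1 with hy
  set k : ℝ := 1 - 1 / y with hk
  have hk1 : k < 1 := by rw [hk]; have : 0 < 1 / y := by positivity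
                         linarith
  set d : ℝ → ℝ := fun t => 1 - k * (1 - t) with hd
  have hdpos : ∀ t ∈ Set.uIcc (0:ℝ) 1, 0 < d t := by
    intro t ht
    rw [Set.uIcc_of_le zero_le_one] at ht
    simp only [hd]
    nlinarith [ht.1, ht.2, mul_nonneg (sub_nonneg.2 hk1.le) (sub_nonneg.2 ht.2)]
  have hdd : ∀ t, HasDerivAt d k t := by
    intro t
    have := (((hasDerivAt_id t).const_sub 1).const_mul k).const_sub 1
    simpa [hd] using this
  have hdc : Continuous d := by fun_prop
  set p : ℝ → ℝ := fun t => k / d t with hp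
  have hpc : ContinuousOn p (Set.uIcc 0 1) :=
    continuousOn_const.div hdc.continuousOn (fun t ht => (hdpos t ht).ne')
  have hpd : ∀ t ∈ Set.uIcc (0:ℝ) 1, HasDerivAt p (-(p t)^2) t := by
    intro t ht
    have := (hasDerivAt_const t k).div (hdd t) (hdpos t ht).ne'
    refine HasDerivAt.congr_deriv (f := p) this ?_
    have := (hdpos t ht).ne'
    have e : p t = k / d t := rfl
    rw [e]; field_simp; ring
  set G : ℝ → ℝ := fun t => -(p t)^2 with hG
  have hGc : ContinuousOn G (Set.uIcc 0 1) := (hpc.pow 2).neg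
  have hGi : IntervalIntegrable G volume 0 1 := hGc.intervalIntegrable
  have hpint : ∀ t ∈ Set.uIcc (0:ℝ) 1, ∫ v in (0:ℝ)..t, G v = p t - p 0 := by
    intro t ht
    have hs : Set.uIcc 0 t ⊆ Set.uIcc (0:ℝ) 1 := Set.uIcc_subset_uIcc (by simp) ht
    exact intervalIntegral.integral_eq_sub_of_hasDerivAt (fun x hx => hpd x (hs hx))
      (hGc.mono hs).intervalIntegrable
  set F : ℝ → ℝ := fun u => 1 + 2 * h u with hF
  have hFi : IntervalIntegrable F volume 0 1 := intervalIntegrable_const.add (hh.const_mul 2)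
  have hfF : ∀ t ∈ Set.uIcc (0:ℝ) 1, ∫ u in (0:ℝ)..t, F u = f t := by
    intro t ht
    have hs : Set.uIcc 0 t ⊆ Set.uIcc (0:ℝ) 1 := Set.uIcc_subset_uIcc (by simp) ht
    rw [hf t (by rwa [Set.uIcc_of_le zero_le_one] at ht), hF,
      intervalIntegral.integral_add intervalIntegrable_const ((hh.mono_set hs).const_mul 2)]
    simp
  have hfc : ContinuousOn f (Set.uIcc 0 1) := by
    have := (hFi.absolutelyContinuousOnInterval_intervalIntegral (c := 0) (by simp)).continuousOn
    exact this.congr (fun t ht => (hfF t ht).symm)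
  have h1 := ibp_zero hFi hGi
  rw [hfF 1 (by simp), hpint 1 (by simp)] at h1
  have h2 : ∫ x in (0:ℝ)..1, (G x * (∫ v in (0:ℝ)..x, F v) + (∫ v in (0:ℝ)..x, G v) * F x)
      = ∫ x in (0:ℝ)..1, ((G x * f x + p x * F x) - p 0 * F x) := by
    apply intervalIntegral.integral_congr
    intro x hx
    simp only [hfF x hx, hpint x hx]; ring
  have hI1 : IntervalIntegrable (fun x => G x * f x + p x * F x) volume 0 1 :=
    (hGc.mul hfc).intervalIntegrable.add (hFi.continuousOn_mul hpc)
  rw [h2, intervalIntegral.integral_sub hI1 (hFi.const_mul _),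
    intervalIntegral.integral_const_mul, hfF 1 (by simp)] at h1
  have h3 : ∫ x in (0:ℝ)..1, (G x * f x + p x * F x) ≤ ∫ x in (0:ℝ)..1, (p x + C x) := by
    apply intervalIntegral.integral_mono_ae_restrict zero_le_one hI1
      (hpc.intervalIntegrable.add hC)
    rw [restrict_Ioc_eq_restrict_Icc] at hineq
    filter_upwards [hineq] with u hu
    have := hu (p u)
    simp only [hG, hF]; nlinarith
  rw [intervalIntegral.integral_add hpc.intervalIntegrable hC] at h3
  have h4 : ∫ x in (0:ℝ)..1, p x = Real.log y := by
    have : ∀ t ∈ Set.uIcc (0:ℝ) 1, HasDerivAt (fun t => Real.log (d t)) (p t) t := by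
      intro t ht
      exact (hdd t).log (hdpos t ht).ne'
    rw [intervalIntegral.integral_eq_sub_of_hasDerivAt this hpc.intervalIntegrable]
    simp [hd, hk]
  have h5 : p 1 = k := by simp [hp, hd]
  have h6 : k * y = y - 1 := by rw [hk]; field_simp
  rw [h5] at h1
  unfold g
  nlinarith

lemma sq_integral_le {F : ℝ → ℝ} (hm : AEStronglyMeasurable F (volume.restrict (Set.Ioc (0:ℝ) 1)))
    (h2 : Integrable (fun u => F u ^ 2) (volume.restrict (Set.Ioc (0:ℝ) 1)))
    {t : ℝ} (ht : t ∈ Set.Icc (0:ℝ) 1) :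
    (∫ u in (0:ℝ)..t, F u) ^ 2 ≤ ∫ u in (0:ℝ)..1, F u ^ 2 := by
  have hF1 : IntervalIntegrable F volume 0 1 := by
    rw [intervalIntegrable_iff_integrableOn_Ioc_of_le zero_le_one]
    exact ((memLp_two_iff_integrable_sq hm).2 h2).integrable (by norm_num)
  have hF2 : IntervalIntegrable (fun u => F u ^ 2) volume 0 1 := by
    rw [intervalIntegrable_iff_integrableOn_Ioc_of_le zero_le_one]; exact h2
  have hs : Set.uIcc 0 t ⊆ Set.uIcc (0:ℝ) 1 := Set.uIcc_subset_uIcc (by simp)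
    (by rwa [Set.uIcc_of_le zero_le_one])
  have hs' : Set.uIcc t 1 ⊆ Set.uIcc (0:ℝ) 1 := Set.uIcc_subset_uIcc
    (by rwa [Set.uIcc_of_le zero_le_one]) (by simp)
  have hG1 := hF1.mono_set hs
  have hG2 := hF2.mono_set hs
  have e : ∫ u in (0:ℝ)..1, F u ^ 2 = (∫ u in (0:ℝ)..t, F u ^ 2) + ∫ u in t..1, F u ^ 2 :=
    (intervalIntegral.integral_add_adjacent_intervals hG2 (hF2.mono_set hs')).symm
  have e1 : 0 ≤ ∫ u in t..1, F u ^ 2 :=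
    intervalIntegral.integral_nonneg ht.2 (fun u _ => sq_nonneg _)
  set I := ∫ u in (0:ℝ)..t, F u with hI
  have e2 : 0 ≤ ∫ u in (0:ℝ)..t, (F u - I) ^ 2 :=
    intervalIntegral.integral_nonneg ht.1 (fun u _ => sq_nonneg _)
  have e3 : ∫ u in (0:ℝ)..t, (F u - I) ^ 2 = (∫ u in (0:ℝ)..t, F u ^ 2) - 2 * I * I + t * I ^ 2 := by
    have : ∀ u, (F u - I) ^ 2 = F u ^ 2 - (2 * I) * F u + I ^ 2 := fun u => by ring
    simp_rw [this]
    rw [intervalIntegral.integral_add (hG2.sub (hG1.const_mul _)) intervalIntegrable_const,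
      intervalIntegral.integral_sub hG2 (hG1.const_mul _), intervalIntegral.integral_const_mul,
      ← hI]
    simp
  nlinarith [ht.2, sq_nonneg I, mul_nonneg (sub_nonneg.2 ht.2) (sq_nonneg I)]

section BM
variable {Ω : Type*} [m0 : MeasurableSpace Ω] {μ : Measure Ω} [IsProbabilityMeasure μ]
  {𝔽 : Filtration ℝ m0} {W : ℝ → Ω → ℝ}

lemma bm_meas (hW : IsBrownianMotion μ 𝔽 W) (t : ℝ) : Measurable (W t) :=
  (hW.adapted t).mono (𝔽.le t) le_rfl

lemma bm_map (hW : IsBrownianMotion μ 𝔽 W) {t : ℝ} (ht : 0 ≤ t) :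
    μ.map (W t) = gaussianReal 0 (Real.toNNReal t) := by
  have := hW.incr_law 0 t le_rfl ht
  simpa [hW.init] using this

lemma bm_memLp (hW : IsBrownianMotion μ 𝔽 W) {t : ℝ} (ht : 0 ≤ t) : MemLp (W t) 2 μ := by
  have h := memLp_id_gaussianReal (μ := 0) (v := Real.toNNReal t) 2
  rw [← bm_map hW ht, memLp_map_measure_iff (by fun_prop) (bm_meas hW t).aemeasurable] at h
  exact h

lemma bm_sq (hW : IsBrownianMotion μ 𝔽 W) {t : ℝ} (ht : 0 ≤ t) : ∫ ω, W t ω ^ 2 ∂μ = t := by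
  have h := variance_id_gaussianReal (μ := 0) (v := Real.toNNReal t)
  rw [variance_of_integral_eq_zero (by fun_prop) (by simp), ← bm_map hW ht,
    integral_map (bm_meas hW t).aemeasurable (by fun_prop)] at h
  simpa [ht] using h

lemma bm_orth (hW : IsBrownianMotion μ 𝔽 W) {s t : ℝ} (hs : 0 ≤ s) (hst : s ≤ t) {Y : Ω → ℝ}
    (hY : StronglyMeasurable[𝔽 s] Y) : ∫ ω, (W t ω - W s ω) * Y ω ∂μ = 0 := by
  have hi : IndepFun (fun ω => W t ω - W s ω) Y μ :=
    indep_of_indep_of_le_right (hW.incr_indep s t hs hst) hY.measurable.comap_le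
  have hm : Measurable (fun ω => W t ω - W s ω) := (bm_meas hW t).sub (bm_meas hW s)
  rw [hi.integral_fun_mul_eq_mul_integral hm.aestronglyMeasurable
    (hY.mono (𝔽.le s)).aestronglyMeasurable]
  have : ∫ ω, (W t ω - W s ω) ∂μ = 0 := by
    have h := integral_id_gaussianReal (μ := 0) (v := Real.toNNReal (t - s))
    rw [← hW.incr_law s t hs hst, integral_map hm.aemeasurable (by fun_prop)] at h
    exact h
  rw [this, zero_mul]

lemma bm_joint (hW : IsBrownianMotion μ 𝔽 W) : StronglyMeasurable (Function.uncurry W) :=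
  stronglyMeasurable_uncurry_of_continuous_of_stronglyMeasurable
    hW.cont (fun t => (bm_meas hW t).stronglyMeasurable)

lemma bm_joint_memLp (hW : IsBrownianMotion μ 𝔽 W) :
    MemLp (Function.uncurry W) 2 ((volume.restrict (Set.Ioc (0:ℝ) 1)).prod μ) := by
  rw [memLp_two_iff_integrable_sq (bm_joint hW).aestronglyMeasurable,
    integrable_prod_iff (f := fun x => Function.uncurry W x ^ 2)
      ((bm_joint hW).pow 2).aestronglyMeasurable]
  constructor
  · filter_upwards [ae_restrict_mem measurableSet_Ioc] with u hu
    exact (bm_memLp hW hu.1.le).integrable_sq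
  · have : Integrable (fun u : ℝ => u) (volume.restrict (Set.Ioc (0:ℝ) 1)) :=
      (continuous_id.integrableOn_Icc (a := (0:ℝ)) (b := 1)).mono_set Set.Ioc_subset_Icc_self
    refine this.congr ?_
    filter_upwards [ae_restrict_mem measurableSet_Ioc] with u hu
    simp [Function.uncurry, bm_sq hW hu.1.le]


lemma drift_joint {φ : ℝ → Ω → ℝ} (hm : StronglyMeasurable (Function.uncurry φ)) :
    AEStronglyMeasurable (fun z : ℝ × Ω => ∫ u in (0:ℝ)..z.1, φ u z.2)
      ((volume.restrict (Set.Ioc (0:ℝ) 1)).prod μ) := by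
  have h1 : StronglyMeasurable (fun q : (ℝ × Ω) × ℝ =>
      {q : (ℝ × Ω) × ℝ | 0 < q.2 ∧ q.2 ≤ q.1.1}.indicator (fun q => φ q.2 q.1.2) q) := by
    refine StronglyMeasurable.indicator ?_ ?_
    · exact hm.comp_measurable (g := fun q : (ℝ × Ω) × ℝ => (q.2, q.1.2)) (by fun_prop)
    · have i1 : Measurable (fun q : (ℝ × Ω) × ℝ => q.2) := by fun_prop
      have i2 : Measurable (fun q : (ℝ × Ω) × ℝ => q.1.1) := by fun_prop
      exact (measurableSet_lt measurable_const i1).inter (measurableSet_le i1 i2)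
  have h2 := h1.integral_prod_right' (ν := (volume : Measure ℝ))
  refine h2.aestronglyMeasurable.congr ?_
  have : ∀ᵐ z ∂((volume.restrict (Set.Ioc (0:ℝ) 1)).prod μ), z.1 ∈ Set.Ioc (0:ℝ) 1 :=
    Measure.quasiMeasurePreserving_fst.ae (ae_restrict_mem measurableSet_Ioc)
  filter_upwards [this] with z hz
  rw [intervalIntegral.integral_of_le hz.1.le, ← integral_indicator measurableSet_Ioc]
  rfl

/-- The standing hypotheses on the drift. -/
structure GoodDrift (μ : Measure Ω) (𝔽 : Filtration ℝ m0) (φ : ℝ → Ω → ℝ) : Prop where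
  meas : StronglyMeasurable (Function.uncurry φ)
  adapted : ∀ u ∈ Set.Icc (0:ℝ) 1, StronglyMeasurable[𝔽 u] (φ u)
  memLp : MemLp (Function.uncurry φ) 2 ((volume.restrict (Set.Ioc (0:ℝ) 1)).prod μ)

variable {φ : ℝ → Ω → ℝ}

lemma GoodDrift.meas_path (h : GoodDrift μ 𝔽 φ) (ω : Ω) : StronglyMeasurable (fun u => φ u ω) :=
  h.meas.comp_measurable (g := fun u : ℝ => (u, ω)) (by fun_prop)

lemma GoodDrift.sq_int (h : GoodDrift μ 𝔽 φ) :
    Integrable (fun z : ℝ × Ω => φ z.1 z.2 ^ 2) ((volume.restrict (Set.Ioc (0:ℝ) 1)).prod μ) :=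
  h.memLp.integrable_sq

lemma GoodDrift.sq_path (h : GoodDrift μ 𝔽 φ) :
    ∀ᵐ ω ∂μ, Integrable (fun u => φ u ω ^ 2) (volume.restrict (Set.Ioc (0:ℝ) 1)) :=
  h.sq_int.prod_left_ae

lemma GoodDrift.path_int (h : GoodDrift μ 𝔽 φ) :
    ∀ᵐ ω ∂μ, IntervalIntegrable (fun u => φ u ω) volume 0 1 := by
  filter_upwards [h.sq_path] with ω hω
  rw [intervalIntegrable_iff_integrableOn_Ioc_of_le zero_le_one]
  exact ((memLp_two_iff_integrable_sq (h.meas_path ω).aestronglyMeasurable).2 hω).integrable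
    (by norm_num)

lemma GoodDrift.sq_marg (h : GoodDrift μ 𝔽 φ) :
    ∀ᵐ u ∂(volume.restrict (Set.Ioc (0:ℝ) 1)), MemLp (φ u) 2 μ := by
  filter_upwards [h.sq_int.prod_right_ae] with u hu
  refine (memLp_two_iff_integrable_sq ?_).2 hu
  exact (h.meas.comp_measurable (g := fun ω : Ω => (u, ω)) (by fun_prop)).aestronglyMeasurable

lemma GoodDrift.drift_le (h : GoodDrift μ 𝔽 φ) :
    ∀ᵐ ω ∂μ, ∀ t ∈ Set.Icc (0:ℝ) 1, (∫ u in (0:ℝ)..t, φ u ω) ^ 2 ≤ ∫ u in (0:ℝ)..1, φ u ω ^ 2 := by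
  filter_upwards [h.sq_path] with ω hω t ht
  exact sq_integral_le (h.meas_path ω).aestronglyMeasurable hω ht

lemma GoodDrift.cost_int (h : GoodDrift μ 𝔽 φ) :
    Integrable (fun ω => ∫ u in (0:ℝ)..1, φ u ω ^ 2) μ := by
  simp_rw [intervalIntegral.integral_of_le zero_le_one]
  exact h.sq_int.integral_prod_right

lemma GoodDrift.drift_memLp (h : GoodDrift μ 𝔽 φ) {t : ℝ} (ht : t ∈ Set.Icc (0:ℝ) 1) :
    MemLp (fun ω => ∫ u in (0:ℝ)..t, φ u ω) 2 μ := by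
  have hm : StronglyMeasurable (fun ω => ∫ u in (0:ℝ)..t, φ u ω) := by
    simp_rw [intervalIntegral.integral_of_le ht.1]
    exact h.meas.integral_prod_left
  refine (memLp_two_iff_integrable_sq hm.aestronglyMeasurable).2 ?_
  refine h.cost_int.mono' (hm.pow 2).aestronglyMeasurable ?_
  filter_upwards [h.drift_le] with ω hω
  rw [Real.norm_of_nonneg (sq_nonneg _)]
  exact hω t ht

lemma GoodDrift.drift_joint_memLp (h : GoodDrift μ 𝔽 φ) :
    MemLp (fun z : ℝ × Ω => ∫ u in (0:ℝ)..z.1, φ u z.2) 2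
      ((volume.restrict (Set.Ioc (0:ℝ) 1)).prod μ) := by
  have hm := drift_joint (μ := μ) h.meas
  refine (memLp_two_iff_integrable_sq hm).2 ?_
  refine (h.cost_int.comp_snd (volume.restrict (Set.Ioc (0:ℝ) 1))).mono' (hm.pow 2) ?_
  have h1 : ∀ᵐ z ∂((volume.restrict (Set.Ioc (0:ℝ) 1)).prod μ), z.1 ∈ Set.Ioc (0:ℝ) 1 :=
    Measure.quasiMeasurePreserving_fst.ae (ae_restrict_mem measurableSet_Ioc)
  have h2 := (Measure.quasiMeasurePreserving_snd
    (μ := volume.restrict (Set.Ioc (0:ℝ) 1)) (ν := μ)).ae h.drift_le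
  filter_upwards [h1, h2] with z hz1 hz2
  rw [Real.norm_of_nonneg (sq_nonneg _)]
  exact hz2 z.1 ⟨hz1.1.le, hz1.2⟩

lemma restr_prod {F : ℝ × Ω → ℝ} (hF : Integrable F ((volume.restrict (Set.Ioc (0:ℝ) 1)).prod μ))
    {t : ℝ} (ht : t ∈ Set.Icc (0:ℝ) 1) :
    Integrable F ((volume.restrict (Set.uIoc (0:ℝ) t)).prod μ) := by
  refine hF.mono_measure (Measure.prod_mono (Measure.restrict_mono ?_ le_rfl) le_rfl)
  rw [Set.uIoc_of_le ht.1]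
  exact Set.Ioc_subset_Ioc_right ht.2

lemma int_Wφ (hW : IsBrownianMotion μ 𝔽 W) (h : GoodDrift μ 𝔽 φ) :
    Integrable (fun z : ℝ × Ω => W z.1 z.2 * φ z.1 z.2)
      ((volume.restrict (Set.Ioc (0:ℝ) 1)).prod μ) :=
  (bm_joint_memLp hW).integrable_mul h.memLp

lemma int_Aφ (h : GoodDrift μ 𝔽 φ) :
    Integrable (fun z : ℝ × Ω => (∫ u in (0:ℝ)..z.1, φ u z.2) * φ z.1 z.2)
      ((volume.restrict (Set.Ioc (0:ℝ) 1)).prod μ) :=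
  h.drift_joint_memLp.integrable_mul h.memLp

lemma interval_int_of_prod {F : ℝ × Ω → ℝ}
    (hF : Integrable F ((volume.restrict (Set.Ioc (0:ℝ) 1)).prod μ)) {t : ℝ}
    (ht : t ∈ Set.Icc (0:ℝ) 1) :
    IntervalIntegrable (fun u => ∫ ω, F (u, ω) ∂μ) volume 0 t := by
  rw [intervalIntegrable_iff]
  exact (restr_prod hF ht).integral_prod_left

lemma cross_term (hW : IsBrownianMotion μ 𝔽 W) (h : GoodDrift μ 𝔽 φ) {t : ℝ}
    (ht : t ∈ Set.Icc (0:ℝ) 1) :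
    ∫ ω, W t ω * (∫ u in (0:ℝ)..t, φ u ω) ∂μ = ∫ u in (0:ℝ)..t, ∫ ω, W u ω * φ u ω ∂μ := by
  have hi : Integrable (fun z : ℝ × Ω => W t z.2 * φ z.1 z.2)
      ((volume.restrict (Set.Ioc (0:ℝ) 1)).prod μ) :=
    ((bm_memLp hW ht.1).comp_snd (volume.restrict (Set.Ioc (0:ℝ) 1))).integrable_mul h.memLp
  simp_rw [← intervalIntegral.integral_const_mul]
  rw [← intervalIntegral_integral_swap (f := fun u ω => W t ω * φ u ω) (restr_prod hi ht)]
  apply intervalIntegral.integral_congr_ae_restrict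
  filter_upwards [(restr_prod hi ht).prod_right_ae, (restr_prod (int_Wφ hW h) ht).prod_right_ae,
    ae_restrict_mem measurableSet_uIoc] with u h1 h2 hu
  rw [Set.uIoc_of_le ht.1] at hu
  have h0 := bm_orth hW hu.1.le hu.2 (h.adapted u ⟨hu.1.le, hu.2.trans ht.2⟩)
  simp_rw [sub_mul] at h0
  rw [integral_sub h1 h2] at h0
  linarith

lemma drift_sq (h : GoodDrift μ 𝔽 φ) {t : ℝ} (ht : t ∈ Set.Icc (0:ℝ) 1) :
    ∫ ω, (∫ u in (0:ℝ)..t, φ u ω) ^ 2 ∂μ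
      = 2 * ∫ u in (0:ℝ)..t, ∫ ω, (∫ v in (0:ℝ)..u, φ v ω) * φ u ω ∂μ := by
  rw [intervalIntegral_integral_swap (f := fun u ω => (∫ v in (0:ℝ)..u, φ v ω) * φ u ω)
    (restr_prod (int_Aφ h) ht), ← integral_const_mul]
  apply integral_congr_ae
  filter_upwards [h.path_int] with ω hω
  refine sq_formula (hω.mono_set ?_)
  exact Set.uIcc_subset_uIcc (by simp) (by rwa [Set.uIcc_of_le zero_le_one])

lemma int_Xφ (hW : IsBrownianMotion μ 𝔽 W) (h : GoodDrift μ 𝔽 φ) :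
    Integrable (fun z : ℝ × Ω => (W z.1 z.2 + ∫ v in (0:ℝ)..z.1, φ v z.2) * φ z.1 z.2)
      ((volume.restrict (Set.Ioc (0:ℝ) 1)).prod μ) := by
  simp_rw [add_mul]
  exact (int_Wφ hW h).add (int_Aφ h)

lemma second_moment (hW : IsBrownianMotion μ 𝔽 W) (h : GoodDrift μ 𝔽 φ) {t : ℝ}
    (ht : t ∈ Set.Icc (0:ℝ) 1) :
    ∫ ω, (W t ω + ∫ u in (0:ℝ)..t, φ u ω) ^ 2 ∂μ
      = t + 2 * ∫ u in (0:ℝ)..t, ∫ ω, (W u ω + ∫ v in (0:ℝ)..u, φ v ω) * φ u ω ∂μ := by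
  have e1 : ∀ ω, (W t ω + ∫ u in (0:ℝ)..t, φ u ω) ^ 2 =
      W t ω ^ 2 + 2 * (W t ω * ∫ u in (0:ℝ)..t, φ u ω) + (∫ u in (0:ℝ)..t, φ u ω) ^ 2 := by
    intro ω; ring
  have hW2 := (bm_memLp hW ht.1).integrable_sq
  have hA2 := (h.drift_memLp ht).integrable_sq
  have hWA : Integrable (fun ω => W t ω * ∫ u in (0:ℝ)..t, φ u ω) μ :=
    (bm_memLp hW ht.1).integrable_mul (h.drift_memLp ht)
  have hS : Integrable (fun ω => W t ω ^ 2 + 2 * (W t ω * ∫ u in (0:ℝ)..t, φ u ω)) μ :=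
    hW2.add (hWA.const_mul 2)
  simp_rw [e1]
  rw [integral_add hS hA2, integral_add hW2 (hWA.const_mul 2),
    integral_const_mul, bm_sq hW ht.1, cross_term hW h ht, drift_sq h ht, add_assoc, ← mul_add,
    ← intervalIntegral.integral_add (interval_int_of_prod (int_Wφ hW h) ht)
      (interval_int_of_prod (int_Aφ h) ht)]
  congr 2
  apply intervalIntegral.integral_congr_ae_restrict
  filter_upwards [(restr_prod (int_Wφ hW h) ht).prod_right_ae,
    (restr_prod (int_Aφ h) ht).prod_right_ae] with u h1 h2
  simp_rw [add_mul]
  rw [integral_add h1 h2]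

lemma good_bound (hW : IsBrownianMotion μ 𝔽 W) (h : GoodDrift μ 𝔽 φ)
    (hpos : 0 < ∫ ω, (W 1 ω + ∫ u in (0:ℝ)..1, φ u ω) ^ 2 ∂μ) :
    g (∫ ω, (W 1 ω + ∫ u in (0:ℝ)..1, φ u ω) ^ 2 ∂μ)
      ≤ ∫ ω, (∫ u in (0:ℝ)..1, φ u ω ^ 2) ∂μ := by
  have h1 : (1:ℝ) ∈ Set.Icc (0:ℝ) 1 := by simp
  rw [← intervalIntegral_integral_swap (f := fun u ω => φ u ω ^ 2) (restr_prod h.sq_int h1)]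
  refine analytic_core (f := fun t => ∫ ω, (W t ω + ∫ u in (0:ℝ)..t, φ u ω) ^ 2 ∂μ)
    (h := fun u => ∫ ω, (W u ω + ∫ v in (0:ℝ)..u, φ v ω) * φ u ω ∂μ)
    (interval_int_of_prod (int_Xφ hW h) h1) (interval_int_of_prod h.sq_int h1)
    (fun t ht => second_moment hW h ht) ?_ hpos
  filter_upwards [h.sq_marg, ae_restrict_mem measurableSet_Ioc] with u hu hu1 p
  have hu2 : u ∈ Set.Icc (0:ℝ) 1 := ⟨hu1.1.le, hu1.2⟩
  have hX : MemLp (fun ω => W u ω + ∫ v in (0:ℝ)..u, φ v ω) 2 μ :=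
    (bm_memLp hW hu2.1).add (h.drift_memLp hu2)
  have hXφ : Integrable (fun ω => (W u ω + ∫ v in (0:ℝ)..u, φ v ω) * φ u ω) μ :=
    hX.integrable_mul hu
  rw [← integral_const_mul, ← integral_const_mul, ← integral_add hu.integrable_sq
    (hX.integrable_sq.const_mul _)]
  refine integral_mono (hXφ.const_mul _) (hu.integrable_sq.add (hX.integrable_sq.const_mul _)) ?_
  intro ω
  simp only [Pi.add_apply]
  nlinarith [sq_nonneg (φ u ω - p * (W u ω + ∫ v in (0:ℝ)..u, φ v ω))]

end BM

theorem penalty_lower_bound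
    {Ω : Type*} [m0 : MeasurableSpace Ω] (μ : Measure Ω) [IsProbabilityMeasure μ]
    (𝔽 : Filtration ℝ m0) (W : ℝ → Ω → ℝ) (hW : IsBrownianMotion μ 𝔽 W)
    (ψ : ℝ → Ω → ℝ) (hprog : ProgMeasurable 𝔽 ψ)
    (hψ2 : ∀ᵐ ω ∂μ, IntervalIntegrable (fun u => (ψ u ω) ^ 2) MeasureTheory.volume 0 1)
    (hmean : ∫ ω, (∫ u in (0:ℝ)..1, ψ u ω) ∂μ = 0) :
    ENNReal.ofReal (g (∫ ω, (W 1 ω + ∫ u in (0:ℝ)..1, ψ u ω) ^ 2 ∂μ)) ≤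
      ∫⁻ ω, ENNReal.ofReal (∫ u in (0:ℝ)..1, (ψ u ω) ^ 2) ∂μ := by

  set L := ∫⁻ ω, ENNReal.ofReal (∫ u in (0:ℝ)..1, (ψ u ω) ^ 2) ∂μ with hL
  rcases eq_or_ne L ⊤ with htop | hfin
  · rw [htop]; exact le_top
  set φ : ℝ → Ω → ℝ := fun u ω => ψ (min u 1) ω with hφ
  have hmeas : StronglyMeasurable (Function.uncurry φ) := by
    have h1 : StronglyMeasurable (fun p : Set.Iic (1:ℝ) × Ω => ψ p.1 p.2) :=
      StronglyMeasurable.mono (hprog 1)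
        (sup_le_sup le_rfl (MeasurableSpace.comap_mono (𝔽.le 1)))
    have h2 : Measurable
        (fun z : ℝ × Ω => ((⟨min z.1 1, Set.mem_Iic.2 (min_le_right _ _)⟩ : Set.Iic (1:ℝ)), z.2)) :=
      ((measurable_fst.min measurable_const).subtype_mk).prodMk measurable_snd
    exact h1.comp_measurable h2
  have heq : ∀ u ≤ (1:ℝ), φ u = ψ u := by
    intro u hu; simp only [hφ, min_eq_left hu]
  have hint : ∀ (F : ℝ → ℝ) ω, ∫ u in (0:ℝ)..1, F (ψ u ω) = ∫ u in (0:ℝ)..1, F (φ u ω) := by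
    intro F ω
    apply intervalIntegral.integral_congr
    intro u hu
    rw [Set.uIcc_of_le zero_le_one] at hu
    simp only [heq u hu.2]
  have hsqm : StronglyMeasurable (fun z : ℝ × Ω => φ z.1 z.2 ^ 2) := hmeas.pow 2
  have hcost : ∫⁻ z, ENNReal.ofReal (φ z.1 z.2 ^ 2)
      ∂((volume.restrict (Set.Ioc (0:ℝ) 1)).prod μ) = L := by
    rw [lintegral_prod_symm _ hsqm.measurable.ennreal_ofReal.aemeasurable, hL]
    apply lintegral_congr_ae
    filter_upwards [hψ2] with ω hω
    rw [hint (fun x => x ^ 2) ω, intervalIntegral.integral_of_le zero_le_one,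
      ofReal_integral_eq_lintegral_ofReal _ (ae_of_all _ fun u => sq_nonneg _)]
    rw [intervalIntegrable_iff_integrableOn_Ioc_of_le zero_le_one] at hω
    refine hω.congr_fun (fun u hu => ?_) measurableSet_Ioc
    simp only [heq u hu.2]
  have hgood : GoodDrift μ 𝔽 φ := by
    refine ⟨hmeas, fun u hu => ?_, ?_⟩
    · rw [heq u hu.2]; exact IsStronglyProgressive.stronglyAdapted hprog u
    · refine (memLp_two_iff_integrable_sq hmeas.aestronglyMeasurable).2
        ⟨hsqm.aestronglyMeasurable, ?_⟩
      rw [hasFiniteIntegral_iff_ofReal (ae_of_all _ fun z => sq_nonneg _)]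
      exact lt_of_eq_of_lt hcost hfin.lt_top
  have hy : ∫ ω, (W 1 ω + ∫ u in (0:ℝ)..1, ψ u ω) ^ 2 ∂μ
      = ∫ ω, (W 1 ω + ∫ u in (0:ℝ)..1, φ u ω) ^ 2 ∂μ := by
    congr 1; ext ω; rw [hint (fun x => x) ω]
  rw [hy]
  have hnn : 0 ≤ ∫ ω, (W 1 ω + ∫ u in (0:ℝ)..1, φ u ω) ^ 2 ∂μ :=
    integral_nonneg fun ω => sq_nonneg _
  rcases hnn.eq_or_lt with h0 | hpos
  · rw [← h0, ENNReal.ofReal_of_nonpos (by simp [g])]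
    exact zero_le
  have hL2 : L = ENNReal.ofReal (∫ ω, (∫ u in (0:ℝ)..1, φ u ω ^ 2) ∂μ) := by
    rw [ofReal_integral_eq_lintegral_ofReal hgood.cost_int (ae_of_all _ fun ω =>
      intervalIntegral.integral_nonneg zero_le_one fun u _ => sq_nonneg _), hL]
    congr 1; ext ω; rw [hint (fun x => x ^ 2) ω]
  rw [hL2]
  exact ENNReal.ofReal_le_ofReal (good_bound hW hgood hpos)
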